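/- Let ≺ be a recursive well-order on the naturals. For a GLP_≺ formula φ whose occurring modalities in ≺-increasing order are λ₀ ≺ λ₁ ≺ … ≺ λ_N, let φ̄ be the condensation of φ obtained by simultaneously replacing each occurrence of [λᵢ] by [i]. Then GLP_≺ ⊢ φ if and only if GLP_ω ⊢ φ̄. -/

import Mathlib

/-!
A formalization of the framework of Fernández-Duque & Joosten,
"The omega-rule interpretation of transfinite provability logic".

We give a deep embedding of the two-sorted language `L²∀` of second-order
arithmetic.  Number variables and (monadic) set variables are indexed by `ℕ`.
The set variable with index `0` is reserved for the binary relation `≺`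
(coded via `Nat.pair`).  Following the paper, the term language contains,
besides `0, S, +, ×`, some auxiliary coding functions: a pairing term, a term
`subnum` computing (the code of) the result of substituting a numeral into
(the formula coded by) its first argument, terms `impC`/`allC` computing codes
of implications and universal closures, and a term `boxC` computing the code
of the formula `[λ]^≺_T φ` from the codes of `λ` and `φ`.

Theories are sets of formulas; provability `Prov` is via Hilbert-style
derivations (two-sorted predicate logic together with Robinson's Arithmetic),
coded as lists of formulas, so that derivations have Gödel codes.
-/

namespace SOA

mutual
inductive Term : Type
  | var  : ℕ → Term
  | zero : Term
  | succ : Term → Term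
  | add  : Term → Term → Term
  | mul  : Term → Term → Term
  | pair : Term → Term → Term
  /-- `subnum s t` codes the result of substituting the numeral of (the value
  of) `t` for the variable `v₀` in the formula coded by (the value of) `s`. -/
  | subnum : Term → Term → Term
  /-- `impC s t` codes the implication of the formulas coded by `s` and `t`. -/
  | impC : Term → Term → Term
  /-- `allC s` codes `∀v₀ ψ` where `ψ` is coded by `s`. -/
  | allC : Term → Term
  /-- `boxC P s t` codes the formula `[s]^≺_T t` (iterated ω-rule provability
  for the theory represented by the proof predicate `P`). -/
  | boxC : Formula → Term → Term → Term

inductive Formula : Type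
  | falsum : Formula
  | eq  : Term → Term → Formula
  | lt  : Term → Term → Formula
  /-- `mem t k` : the value of `t` belongs to the set variable `X_k`. -/
  | mem : Term → ℕ → Formula
  | imp : Formula → Formula → Formula
  | all : ℕ → Formula → Formula
  | allSet : ℕ → Formula → Formula
end

instance : Nonempty Formula := ⟨Formula.falsum⟩

namespace Formula
def neg (a : Formula) : Formula := imp a falsum
def and (a b : Formula) : Formula := neg (imp a (neg b))
def or (a b : Formula) : Formula := imp (neg a) b
def iff (a b : Formula) : Formula := and (imp a b) (imp b a)
def ex (x : ℕ) (a : Formula) : Formula := neg (all x (neg a))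
def exSet (k : ℕ) (a : Formula) : Formula := neg (allSet k (neg a))
end Formula

/-- The numeral `n̄`. -/
def numeral : ℕ → Term
  | 0 => .zero
  | n + 1 => .succ (numeral n)

/-! ### Substitution and free variables -/

mutual
/-- Substitute the term `s` for the number variable `x` in a term. -/
def substT (x : ℕ) (s : Term) : Term → Term
  | .var n => if n = x then s else .var n
  | .zero => .zero
  | .succ t => .succ (substT x s t)
  | .add a b => .add (substT x s a) (substT x s b)
  | .mul a b => .mul (substT x s a) (substT x s b)
  | .pair a b => .pair (substT x s a) (substT x s b)
  | .subnum a b => .subnum (substT x s a) (substT x s b)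
  | .impC a b => .impC (substT x s a) (substT x s b)
  | .allC a => .allC (substT x s a)
  | .boxC P a b => .boxC P (substT x s a) (substT x s b)

/-- Substitute the term `s` for the number variable `x` in a formula. -/
def substF (x : ℕ) (s : Term) : Formula → Formula
  | .falsum => .falsum
  | .eq a b => .eq (substT x s a) (substT x s b)
  | .lt a b => .lt (substT x s a) (substT x s b)
  | .mem t k => .mem (substT x s t) k
  | .imp a b => .imp (substF x s a) (substF x s b)
  | .all y a => if y = x then .all y a else .all y (substF x s a)
  | .allSet k a => .allSet k (substF x s a)
end

mutual
/-- Number variables occurring in a term. -/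
def fvT : Term → Set ℕ
  | .var n => {n}
  | .zero => ∅
  | .succ t => fvT t
  | .add a b => fvT a ∪ fvT b
  | .mul a b => fvT a ∪ fvT b
  | .pair a b => fvT a ∪ fvT b
  | .subnum a b => fvT a ∪ fvT b
  | .impC a b => fvT a ∪ fvT b
  | .allC a => fvT a
  | .boxC _ a b => fvT a ∪ fvT b

/-- Free number variables of a formula. -/
def fvF : Formula → Set ℕ
  | .falsum => ∅
  | .eq a b => fvT a ∪ fvT b
  | .lt a b => fvT a ∪ fvT b
  | .mem t _ => fvT t
  | .imp a b => fvF a ∪ fvF b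
  | .all y a => fvF a \ {y}
  | .allSet _ a => fvF a
end

/-- Free set variables of a formula. -/
def fsF : Formula → Set ℕ
  | .falsum => ∅
  | .eq _ _ => ∅
  | .lt _ _ => ∅
  | .mem _ k => {k}
  | .imp a b => fsF a ∪ fsF b
  | .all _ a => fsF a
  | .allSet k a => fsF a \ {k}

/-- `Substl s x φ`: the term `s` is substitutable (capture-free) for the
number variable `x` in `φ`. -/
def Substl (s : Term) (x : ℕ) : Formula → Prop
  | .falsum => True
  | .eq _ _ => True
  | .lt _ _ => True
  | .mem _ _ => True
  | .imp a b => Substl s x a ∧ Substl s x b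
  | .all y a => x ∉ fvF (.all y a) ∨ (y ∉ fvT s ∧ Substl s x a)
  | .allSet _ a => Substl s x a

/-- Rename the free set variable `k` to `j`. -/
def substS (k j : ℕ) : Formula → Formula
  | .falsum => .falsum
  | .eq a b => .eq a b
  | .lt a b => .lt a b
  | .mem t m => .mem t (if m = k then j else m)
  | .imp a b => .imp (substS k j a) (substS k j b)
  | .all y a => .all y (substS k j a)
  | .allSet m a => if m = k then .allSet m a else .allSet m (substS k j a)

/-- The set variable `j` is substitutable for `k` in `φ`. -/
def SubstlS (j k : ℕ) : Formula → Prop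
  | .falsum => True
  | .eq _ _ => True
  | .lt _ _ => True
  | .mem _ _ => True
  | .imp a b => SubstlS j k a ∧ SubstlS j k b
  | .all _ a => SubstlS j k a
  | .allSet m a => k ∉ fsF (.allSet m a) ∨ (m ≠ j ∧ SubstlS j k a)

/-! ### Gödel numbering -/

mutual
/-- Gödel numbering of terms. -/
def encT : Term → ℕ
  | .var n => Nat.pair 0 n
  | .zero => Nat.pair 1 0
  | .succ t => Nat.pair 2 (encT t)
  | .add a b => Nat.pair 3 (Nat.pair (encT a) (encT b))
  | .mul a b => Nat.pair 4 (Nat.pair (encT a) (encT b))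
  | .pair a b => Nat.pair 5 (Nat.pair (encT a) (encT b))
  | .subnum a b => Nat.pair 6 (Nat.pair (encT a) (encT b))
  | .impC a b => Nat.pair 7 (Nat.pair (encT a) (encT b))
  | .allC a => Nat.pair 8 (encT a)
  | .boxC P a b => Nat.pair 9 (Nat.pair (encF P) (Nat.pair (encT a) (encT b)))

/-- Gödel numbering of formulas. -/
def encF : Formula → ℕ
  | .falsum => Nat.pair 0 0
  | .eq a b => Nat.pair 1 (Nat.pair (encT a) (encT b))
  | .lt a b => Nat.pair 2 (Nat.pair (encT a) (encT b))
  | .mem t k => Nat.pair 3 (Nat.pair (encT t) k)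
  | .imp a b => Nat.pair 4 (Nat.pair (encF a) (encF b))
  | .all x a => Nat.pair 5 (Nat.pair x (encF a))
  | .allSet k a => Nat.pair 6 (Nat.pair k (encF a))
end

/-- Decoding of formulas (a left inverse of `encF`). -/
noncomputable def decF : ℕ → Formula := Function.invFun encF

/-- Gödel numbering of (lists of formulas, representing) derivations. -/
def encL (l : List Formula) : ℕ := l.foldr (fun a n => Nat.pair (encF a) n + 1) 0

/-! ### The logical calculus: two-sorted predicate logic + Robinson Arithmetic -/

/-- Logical axioms (including Robinson's Arithmetic and equality axioms). -/
inductive LogAx : Formula → Prop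
  | p1 (a b) : LogAx (.imp a (.imp b a))
  | p2 (a b c) : LogAx (.imp (.imp a (.imp b c)) (.imp (.imp a b) (.imp a c)))
  | dne (a) : LogAx (.imp (.imp (.imp a .falsum) .falsum) a)
  | allElim (x t a) : Substl t x a → LogAx (.imp (.all x a) (substF x t a))
  | allDist (x a b) : LogAx (.imp (.all x (.imp a b)) (.imp (.all x a) (.all x b)))
  | allVac (x a) : x ∉ fvF a → LogAx (.imp a (.all x a))
  | setElim (k j a) : SubstlS j k a → LogAx (.imp (.allSet k a) (substS k j a))
  | setDist (k a b) : LogAx (.imp (.allSet k (.imp a b)) (.imp (.allSet k a) (.allSet k b)))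
  | setVac (k a) : k ∉ fsF a → LogAx (.imp a (.allSet k a))
  | eqRefl (t) : LogAx (.eq t t)
  | eqSubst (x s t a) : Substl s x a → Substl t x a →
      LogAx (.imp (.eq s t) (.imp (substF x s a) (substF x t a)))
  | q1 : LogAx (.all 0 (.neg (.eq (.succ (.var 0)) .zero)))
  | q2 : LogAx (.all 0 (.all 1 (.imp (.eq (.succ (.var 0)) (.succ (.var 1)))
      (.eq (.var 0) (.var 1)))))
  | q3 : LogAx (.all 0 (.imp (.neg (.eq (.var 0) .zero)) (.ex 1 (.eq (.var 0) (.succ (.var 1))))))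
  | q4 : LogAx (.all 0 (.eq (.add (.var 0) .zero) (.var 0)))
  | q5 : LogAx (.all 0 (.all 1 (.eq (.add (.var 0) (.succ (.var 1)))
      (.succ (.add (.var 0) (.var 1))))))
  | q6 : LogAx (.all 0 (.eq (.mul (.var 0) .zero) .zero))
  | q7 : LogAx (.all 0 (.all 1 (.eq (.mul (.var 0) (.succ (.var 1)))
      (.add (.mul (.var 0) (.var 1)) (.var 0)))))
  | qlt : LogAx (.all 0 (.all 1 (.iff (.lt (.var 0) (.var 1))
      (.ex 2 (.eq (.add (.succ (.var 2)) (.var 0)) (.var 1))))))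

/-- The `i`-th entry of `l` is justified as a step of a Hilbert-style
derivation from the theory `T`: it is an axiom of `T`, a logical axiom, or it
follows from earlier entries by Modus Ponens or Generalization (for either
sort). -/
def Justified (T : Set Formula) (l : List Formula) (i : ℕ) : Prop :=
  ∃ φ, l[i]? = some φ ∧
    (φ ∈ T ∨ LogAx φ ∨
      (∃ j k ψ, j < i ∧ k < i ∧ l[j]? = some ψ ∧ l[k]? = some (Formula.imp ψ φ)) ∨
      (∃ j ψ x, j < i ∧ l[j]? = some ψ ∧ φ = Formula.all x ψ) ∨
      (∃ j ψ k, j < i ∧ l[j]? = some ψ ∧ φ = Formula.allSet k ψ))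

/-- `l` is a derivation from the theory `T`. -/
def IsDeriv (T : Set Formula) (l : List Formula) : Prop :=
  l ≠ [] ∧ ∀ i < l.length, Justified T l i

/-- `φ` is provable from the theory `T` (in two-sorted predicate logic with
Robinson's Arithmetic). -/
def Prov (T : Set Formula) (φ : Formula) : Prop :=
  ∃ l, IsDeriv T l ∧ l.getLast? = some φ

/-- `T` is consistent. -/
def Con (T : Set Formula) : Prop := ¬ Prov T .falsum

/-- `ProofCode T d f`: `d` is the code of a derivation in `T` of the formula
coded by `f`. -/
def ProofCode (T : Set Formula) (d f : ℕ) : Prop :=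
  ∃ (l : List Formula) (φ : Formula),
    IsDeriv T l ∧ l.getLast? = some φ ∧ d = encL l ∧ f = encF φ

/-! ### Formula classes -/

/-- `Δ̂⁰₀` formulas: only bounded number quantifiers and no set variables. -/
inductive IsDelta0 : Formula → Prop
  | falsum : IsDelta0 .falsum
  | eq (a b) : IsDelta0 (.eq a b)
  | lt (a b) : IsDelta0 (.lt a b)
  | imp {a b} : IsDelta0 a → IsDelta0 b → IsDelta0 (.imp a b)
  | ball {a} (x t) : IsDelta0 a → IsDelta0 (.all x (.imp (.lt (.var x) t) a))

/-- `Δ⁰₀` formulas (set parameters allowed). -/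
inductive IsDelta0p : Formula → Prop
  | falsum : IsDelta0p .falsum
  | eq (a b) : IsDelta0p (.eq a b)
  | lt (a b) : IsDelta0p (.lt a b)
  | mem (t k) : IsDelta0p (.mem t k)
  | imp {a b} : IsDelta0p a → IsDelta0p b → IsDelta0p (.imp a b)
  | ball {a} (x t) : IsDelta0p a → IsDelta0p (.all x (.imp (.lt (.var x) t) a))

/-- `Σ̂⁰₁` formulas (no free set variables). -/
def IsSigma1 (σ : Formula) : Prop := ∃ x δ, IsDelta0 δ ∧ (σ = .ex x δ ∨ σ = δ)

/-- `Σ⁰₁` formulas (set parameters allowed). -/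
def IsSigma1p (σ : Formula) : Prop := ∃ x δ, IsDelta0p δ ∧ (σ = .ex x δ ∨ σ = δ)

/-- Arithmetic (`Π⁰ω`) formulas: no set quantifiers (set parameters allowed). -/
def IsArith : Formula → Prop
  | .imp a b => IsArith a ∧ IsArith b
  | .all _ a => IsArith a
  | .allSet _ _ => False
  | _ => True

/-! ### The iterated provability formulas -/

/-- `s ≺ t`, where the relation coded (via pairing) by the set variable `X_r`. -/
def precAt (r : ℕ) (s t : Term) : Formula := .mem (.pair s t) r

/-- `s ≺ t`, where `≺` is the designated set variable `X₀`. -/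
def precF (s t : Term) : Formula := precAt 0 s t

/-- `□_T t` : the formula coded by (the value of) `t` is provable in `T`,
where `P` is the `Δ̂⁰₀` proof predicate of `T` (with free variables `v₀`
for the derivation and `v₁` for the formula). -/
def BoxF (P : Formula) (t : Term) : Formula :=
  .ex 1 (.and (.eq (.var 1) t) (.ex 0 P))

/-- The formula `IPC^≺_T(X)`, for a "class" `X` given by the membership
formula `M`: for all `z`, `M z` holds iff `z = ⟨λ,φ⟩` where either `□_T φ`,
or there are `ψ` and `ξ ≺ λ` such that `M ⟨ξ, ψ(n̄)⟩` for every `n` and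
`□_T (∀x ψ(x) → φ)`. -/
def IPCmem (P : Formula) (M : Term → Formula) : Formula :=
  .all 2 (.iff (M (.var 2))
    (.ex 3 (.ex 4 (.and (.eq (.var 2) (.pair (.var 3) (.var 4)))
      (.or (BoxF P (.var 4))
        (.ex 5 (.ex 6 (.and (precF (.var 6) (.var 3))
          (.and (.all 7 (M (.pair (.var 6) (.subnum (.var 5) (.var 7)))))
            (BoxF P (.impC (.allC (.var 5)) (.var 4))))))))))))

/-- `IPC^≺_T(X_k)` : the set variable `X_k` is an iterated provability class
for the theory with proof predicate `P`, along the order `≺` (= `X₀`). -/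
def IPCat (P : Formula) (k : ℕ) : Formula := IPCmem P (fun t => .mem t k)

/-- `[l]^≺_T f` for terms `l` (the ordinal) and `f` (the code of a formula):
`∀X (IPC^≺_T(X) → ⟨l,f⟩ ∈ X)`. -/
def BoxIterT (P : Formula) (l f : Term) : Formula :=
  .allSet 1 (.imp (IPCat P 1) (.mem (.pair l f) 1))

/-- `[λ]^≺_T φ` : iterated ω-rule provability of `φ`, `λ` nested applications
of the ω-rule along `≺`. -/
def boxIter (P : Formula) (lam : ℕ) (φ : Formula) : Formula :=
  BoxIterT P (numeral lam) (numeral (encF φ))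

/-- A term computing the code of the negation of the formula coded by `t`. -/
def negC (t : Term) : Term := .impC t (numeral (encF .falsum))

/-- `⟨l⟩^≺_T f = ¬[l]^≺_T ¬f` for terms `l`, `f`. -/
def DiaIterT (P : Formula) (l f : Term) : Formula := .neg (BoxIterT P l (negC f))

/-- `⟨λ⟩^≺_T φ`. -/
def diaIter (P : Formula) (lam : ℕ) (φ : Formula) : Formula :=
  .neg (boxIter P lam (.neg φ))

/-- A term computing the code of `⟨l⟩^≺_T f` from terms `l`, `f`. -/
def diaCodeT (P : Formula) (l f : Term) : Term := negC (.boxC P l (negC f))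

/-- The introspection axiom `∃X IPC^≺_T(X)`. -/
def introAx (P : Formula) : Formula := .exSet 1 (IPCat P 1)

/-! ### Well-orders, and some standard systems of second-order arithmetic -/

/-- `≺` (coded by `X_r`) is a linear (strict total) order. -/
def linFat (r : ℕ) : Formula :=
  .and (.all 2 (.and (.neg (precAt r (.var 2) (.var 2)))
         (.all 3 (.or (precAt r (.var 2) (.var 3))
           (.or (precAt r (.var 3) (.var 2)) (.eq (.var 3) (.var 2)))))))
       (.all 2 (.all 3 (.all 4 (.imp (.and (precAt r (.var 2) (.var 3))
         (precAt r (.var 3) (.var 4))) (precAt r (.var 2) (.var 4))))))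

/-- `wo(≺)` for the relation coded by `X_r` (`X` the bound set variable):
`≺` is linear and every nonempty set has a `≺`-minimal element. -/
def woFat (r X : ℕ) : Formula :=
  .and (linFat r) (.allSet X (.imp (.ex 2 (.mem (.var 2) X))
    (.ex 3 (.all 4 (.imp (precAt r (.var 4) (.var 3)) (.neg (.mem (.var 4) X)))))))

/-- `wo(≺)` for the designated order `≺` (= `X₀`). -/
def woF : Formula := woFat 0 1

/-- The comprehension instance `∃X_k ∀x (x ∈ X_k ↔ φ)`. -/
def CAinst (k x : ℕ) (φ : Formula) : Formula :=
  .exSet k (.all x (.iff (.mem (.var x) k) φ))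

/-- The set induction axiom `Ind`. -/
def IndAx : Formula :=
  .allSet 1 (.imp (.all 2 (.imp (.all 3 (.imp (.lt (.var 3) (.var 2))
      (.mem (.var 3) 1))) (.mem (.var 2) 1)))
    (.all 2 (.mem (.var 2) 1)))

/-- The induction axiom instance `φ(0) ∧ ∀x(φ(x) → φ(x+1)) → ∀x φ(x)`. -/
def IndInst (x : ℕ) (φ : Formula) : Formula :=
  .imp (.and (substF x .zero φ) (.all x (.imp φ (substF x (.succ (.var x)) φ))))
       (.all x φ)

/-- `ACA₀ = Ind + Π⁰ω-CA`. -/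
def ACA0 : Set Formula :=
  insert IndAx { ψ | ∃ k x φ, IsArith φ ∧ k ∉ fsF φ ∧ ψ = CAinst k x φ }

/-- `U` extends `ACA₀`. -/
def ExtACA0 (U : Set Formula) : Prop := ∀ φ ∈ ACA0, Prov U φ

/-- `RCA₀ = I-Σ⁰₁ + Δ⁰₀-CA`. -/
def RCA0 : Set Formula :=
  { ψ | ∃ x φ, IsSigma1p φ ∧ ψ = IndInst x φ } ∪
  { ψ | ∃ k x φ, IsDelta0p φ ∧ k ∉ fsF φ ∧ ψ = CAinst k x φ }

/-- The `Δ̂⁰₀` comprehension scheme (no set parameters). -/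
def Delta0HatCA : Set Formula :=
  { ψ | ∃ k x φ, IsDelta0 φ ∧ ψ = CAinst k x φ }

/-- The `Δ⁰₀` comprehension scheme (set parameters allowed). -/
def Delta0pCA : Set Formula :=
  { ψ | ∃ k x φ, IsDelta0p φ ∧ k ∉ fsF φ ∧ ψ = CAinst k x φ }

/-! ### Semantics in the standard model -/

/-- Evaluation of terms in the standard model under the number-variable
assignment `v`. -/
noncomputable def evT (v : ℕ → ℕ) : Term → ℕ
  | .var n => v n
  | .zero => 0
  | .succ t => evT v t + 1
  | .add a b => evT v a + evT v b
  | .mul a b => evT v a * evT v b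
  | .pair a b => Nat.pair (evT v a) (evT v b)
  | .subnum a b => encF (substF 0 (numeral (evT v b)) (decF (evT v a)))
  | .impC a b => encF (.imp (decF (evT v a)) (decF (evT v b)))
  | .allC a => encF (.all 0 (decF (evT v a)))
  | .boxC P a b => encF (BoxIterT P (numeral (evT v a)) (numeral (evT v b)))

/-- Truth in the (full) standard model, under the number-variable assignment
`v` and the set-variable assignment `S`. -/
def EvF : (ℕ → ℕ) → (ℕ → Set ℕ) → Formula → Prop
  | _, _, .falsum => (False : Prop)
  | v, _, .eq a b => evT v a = evT v b
  | v, _, .lt a b => evT v a < evT v b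
  | v, S, .mem t k => evT v t ∈ S k
  | v, S, .imp a b => EvF v S a → EvF v S b
  | v, S, .all x a => ∀ n : ℕ, EvF (Function.update v x n) S a
  | v, S, .allSet k a => ∀ A : Set ℕ, EvF v (Function.update S k A) a

/-- The graph (set of codes of pairs) of a binary relation on `ℕ`. -/
def relSet (R : ℕ → ℕ → Prop) : Set ℕ := {p | ∃ a b, p = Nat.pair a b ∧ R a b}

/-- `T` is sound (all its theorems are true in the standard model), where the
designated set variable `X₀` is interpreted as the fixed relation `R`. -/
def SoundFor (R : ℕ → ℕ → Prop) (T : Set Formula) : Prop :=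
  ∀ φ, Prov T φ → ∀ (v : ℕ → ℕ) (S : ℕ → Set ℕ), S 0 = relSet R → EvF v S φ

/-- `T` is representable via the `Δ̂⁰₀` proof predicate `P` (with free
variables `v₀`, `v₁`): `P(d,f)` holds (in the standard model) iff `d` codes a
derivation in `T` of the formula coded by `f`. -/
def Represents (T : Set Formula) (P : Formula) : Prop :=
  IsDelta0 P ∧
  ∀ (d f : ℕ) (v : ℕ → ℕ) (S : ℕ → Set ℕ),
    (EvF (Function.update (Function.update v 0 d) 1 f) S P ↔ ProofCode T d f)

/-- The formula `σ` (with free variables `v₀`, `v₁`) defines the relation `R`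
in the standard model. -/
def DefinesRel (σ : Formula) (R : ℕ → ℕ → Prop) : Prop :=
  ∀ (a b : ℕ) (v : ℕ → ℕ) (S : ℕ → Set ℕ),
    (EvF (Function.update (Function.update v 0 a) 1 b) S σ ↔ R a b)

/-- The axiom `∀x∀y (x ≺ y ↔ σ(x,y))` expressing that `≺` is (defined by) the
formula `σ`. -/
def precDefAx (σ : Formula) : Formula :=
  .all 0 (.all 1 (.iff (precF (.var 0) (.var 1)) σ))

/-! ### The modal language and the logics `GLP_≺` -/

/-- Modal formulas of the language `L_[·]`, with a modality `[ξ]` for each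
natural number `ξ`. -/
inductive MF : Type
  | var : ℕ → MF
  | bot : MF
  | imp : MF → MF → MF
  | box : ℕ → MF → MF

namespace MF
def neg (a : MF) : MF := imp a bot
def dia (n : ℕ) (a : MF) : MF := neg (box n (neg a))
end MF

/-- Substitution of modal formulas for propositional variables. -/
def msub (σ : ℕ → MF) : MF → MF
  | .var p => σ p
  | .bot => .bot
  | .imp a b => .imp (msub σ a) (msub σ b)
  | .box n a => .box n (msub σ a)

/-- `φ` is a propositional tautology (boxed formulas treated as atoms). -/
def MTaut (φ : MF) : Prop :=
  ∀ w : MF → Prop, ¬ w .bot → (∀ a b, w (.imp a b) ↔ (w a → w b)) → w φ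

/-- The logic `GLP_≺` for a binary relation `R` (`≺`) on the naturals:
propositional tautologies, distribution, Löb's axiom, monotonicity
`⟨ζ⟩φ → ⟨ξ⟩φ` and `⟨ξ⟩φ → [ζ]⟨ξ⟩φ` for `ξ ≺ ζ`, with the rules Modus Ponens,
Substitution and Necessitation. -/
inductive GLP (R : ℕ → ℕ → Prop) : MF → Prop
  | taut {a} : MTaut a → GLP R a
  | k (n a b) : GLP R (.imp (.box n (.imp a b)) (.imp (.box n a) (.box n b)))
  | lob (n a) : GLP R (.imp (.box n (.imp (.box n a) a)) (.box n a))
  | mono {ξ ζ} (a) : R ξ ζ → GLP R (.imp (MF.dia ζ a) (MF.dia ξ a))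
  | stab {ξ ζ} (a) : R ξ ζ → GLP R (.imp (MF.dia ξ a) (.box ζ (MF.dia ξ a)))
  | mp {a b} : GLP R (.imp a b) → GLP R a → GLP R b
  | subst {a} (σ) : GLP R a → GLP R (msub σ a)
  | nec {a} (n) : GLP R a → GLP R (.box n a)

/-- The extension `f^≺_T` of an arithmetic interpretation `f` to all modal
formulas: it commutes with the Booleans and sends `[λ]φ` to `[λ]^≺_T f(φ)`. -/
def interp (P : Formula) (f : ℕ → Formula) : MF → Formula
  | .var p => f p
  | .bot => .falsum
  | .imp a b => .imp (interp P f a) (interp P f b)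
  | .box n a => boxIter P n (interp P f a)

/-- Relabelling of modalities by `g`. -/
def mapMod (g : ℕ → ℕ) : MF → MF
  | .var p => .var p
  | .bot => .bot
  | .imp a b => .imp (mapMod g a) (mapMod g b)
  | .box n a => .box (g n) (mapMod g a)

/-! ### Calculi without substitution over a finite list of modalities -/

/-- The substitution-free fragment of `GLP R` in which only the modalities listed in `l` obey
axioms and rules; boxes of all other modalities behave as atoms. -/
inductive GLPOn (R : ℕ → ℕ → Prop) (l : List ℕ) : MF → Prop
  | taut {a} : MTaut a → GLPOn R l a
  | k (n a b) : n ∈ l → GLPOn R l (.imp (.box n (.imp a b)) (.imp (.box n a) (.box n b)))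
  | lob (n a) : n ∈ l → GLPOn R l (.imp (.box n (.imp (.box n a) a)) (.box n a))
  | mono {ξ ζ} (a) : ξ ∈ l → ζ ∈ l → R ξ ζ → GLPOn R l (.imp (MF.dia ζ a) (MF.dia ξ a))
  | stab {ξ ζ} (a) : ξ ∈ l → ζ ∈ l → R ξ ζ →
      GLPOn R l (.imp (MF.dia ξ a) (.box ζ (MF.dia ξ a)))
  | mp {a b} : GLPOn R l (.imp a b) → GLPOn R l a → GLPOn R l b
  | nec {a} (n) : n ∈ l → GLPOn R l a → GLPOn R l (.box n a)

theorem GLPOn.weaken {R : ℕ → ℕ → Prop} {l l' : List ℕ} (h : ∀ x ∈ l, x ∈ l') {a : MF}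
    (ha : GLPOn R l a) : GLPOn R l' a := by
  induction ha with
  | taut h1 => exact .taut h1
  | k n a b hn => exact .k n a b (h _ hn)
  | lob n a hn => exact .lob n a (h _ hn)
  | mono a h1 h2 h3 => exact .mono a (h _ h1) (h _ h2) h3
  | stab a h1 h2 h3 => exact .stab a (h _ h1) (h _ h2) h3
  | mp _ _ i1 i2 => exact .mp i1 i2
  | nec n hn _ i => exact .nec n (h _ hn) i

/-- Boolean valuations of modal formulas, boxed formulas being atoms. -/
def IsVal (w : MF → Prop) : Prop := ¬ w .bot ∧ ∀ a b, w (.imp a b) ↔ (w a → w b)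

theorem IsVal.neg {w : MF → Prop} (hw : IsVal w) (a : MF) : w a.neg ↔ ¬ w a := by
  simp only [MF.neg, hw.2, hw.1]

/-- Points of the canonical model of `GLPOn R l`. -/
def IsPoint (R : ℕ → ℕ → Prop) (l : List ℕ) (w : MF → Prop) : Prop :=
  IsVal w ∧ ∀ a, GLPOn R l a → w a

/-- Propositional theories: sets with all tautologies, closed under modus ponens. -/
def IsTheory (T : Set MF) : Prop :=
  (∀ a, MTaut a → a ∈ T) ∧ ∀ a b, MF.imp a b ∈ T → a ∈ T → b ∈ T

theorem IsTheory.exists_val {T : Set MF} (hT : IsTheory T) {φ : MF} (hφ : φ ∉ T) :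
    ∃ w, IsVal w ∧ (∀ a ∈ T, w a) ∧ ¬ w φ := by
  obtain ⟨M, hTM, hM⟩ := zorn_subset_nonempty {S | IsTheory S ∧ φ ∉ S} (by
    intro c hc hchain hne
    refine ⟨⋃₀ c, ⟨⟨fun a ha => ?_, fun a b hab ha => ?_⟩, ?_⟩, fun s hs =>
      Set.subset_sUnion_of_mem hs⟩
    · obtain ⟨s, hs⟩ := hne
      exact ⟨s, hs, (hc hs).1.1 a ha⟩
    · obtain ⟨s, hs, hab⟩ := hab
      obtain ⟨t, ht, ha⟩ := ha
      rcases hchain.total hs ht with h | h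
      · exact ⟨t, ht, (hc ht).1.2 a b (h hab) ha⟩
      · exact ⟨s, hs, (hc hs).1.2 a b hab (h ha)⟩
    · rintro ⟨s, hs, h⟩
      exact (hc hs).2 h) T ⟨hT, hφ⟩
  obtain ⟨hMT, hMφ⟩ := hM.prop
  have key : ∀ a, a ∉ M ↔ MF.imp a φ ∈ M := by
    intro a
    constructor
    · intro ha
      by_contra h
      have hle : M ⊆ {b | MF.imp a b ∈ M} := fun b hb =>
        hMT.2 _ _ (hMT.1 _ (fun w _ hi => by simp only [hi]; tauto)) hb
      have hin : {b | MF.imp a b ∈ M} ∈ {S | IsTheory S ∧ φ ∉ S} := by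
        refine ⟨⟨fun b hb => hle (hMT.1 b hb), fun b c hbc hb => ?_⟩, h⟩
        refine hMT.2 _ _ (hMT.2 _ _ (hMT.1 _ (fun w _ hi => ?_)) hbc) hb
        simp only [hi]; tauto
      exact ha (hM.le_of_ge hin hle (hMT.1 (.imp a a) (fun w _ hi => by simp only [hi]; tauto)))
    · intro h ha
      exact hMφ (hMT.2 _ _ h ha)
  refine ⟨fun a => a ∈ M, ⟨?_, fun a b => ⟨hMT.2 a b, fun h => ?_⟩⟩, fun a ha => hTM ha, hMφ⟩
  · exact (key _).2 (hMT.1 _ (fun w hb hi => by simp only [hi]; tauto))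
  · by_cases ha : a ∈ M
    · exact hMT.2 _ _ (hMT.1 _ (fun w _ hi => by simp only [hi]; tauto)) (h ha)
    · by_contra hab
      rw [key] at ha hab
      refine hMφ (hMT.2 _ _ (hMT.2 _ _ (hMT.1 _ (fun w _ hi => ?_)) ha) hab)
      simp only [hi]; tauto

section Canonical

variable {R : ℕ → ℕ → Prop} {l : List ℕ}

theorem glpOn_iff_forall_point (φ : MF) : GLPOn R l φ ↔ ∀ w, IsPoint R l w → w φ := by
  refine ⟨fun h w hw => hw.2 _ h, fun h => ?_⟩
  by_contra hφ
  obtain ⟨w, hw, hT, hn⟩ := IsTheory.exists_val (T := {a | GLPOn R l a})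
    ⟨fun a ha => .taut ha, fun a b => .mp⟩ hφ
  exact hn (h w ⟨hw, hT⟩)

theorem IsPoint.box_mp {w : MF → Prop} (hw : IsPoint R l w) {m : ℕ} (hm : m ∈ l) {a b : MF}
    (hab : w (.box m (.imp a b))) (ha : w (.box m a)) : w (.box m b) := by
  have := hw.2 _ (.k m a b hm)
  simp only [hw.1.2] at this
  exact this hab ha

theorem IsPoint.exists_succ {w : MF → Prop} (hw : IsPoint R l w) {m : ℕ} (hm : m ∈ l) {a : MF}
    (ha : ¬ w (.box m a)) : ∃ v, IsPoint R l v ∧ ¬ v a ∧ ∀ b, w (.box m b) → v b := by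
  obtain ⟨v, hv, hT, hn⟩ := IsTheory.exists_val (T := {b | w (.box m b)})
    ⟨fun b hb => hw.2 _ (.nec m hm (.taut hb)), fun b c => hw.box_mp hm⟩ ha
  exact ⟨v, ⟨hv, fun b hb => hT b (hw.2 _ (.nec m hm hb))⟩, hn, hT⟩

theorem IsPoint.box_of_forall {w : MF → Prop} (hw : IsPoint R l w) {m : ℕ} (hm : m ∈ l) {a : MF}
    (h : ∀ v, IsPoint R l v → (∀ b, w (.box m b) → v b) → v a) : w (.box m a) := by
  by_contra ha
  obtain ⟨v, hv, hn, hs⟩ := hw.exists_succ hm ha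
  exact hn (h v hv hs)

theorem IsPoint.exists_succ_box {w : MF → Prop} (hw : IsPoint R l w) {m : ℕ} (hm : m ∈ l) {a : MF}
    (ha : ¬ w (.box m a)) :
    ∃ v, IsPoint R l v ∧ ¬ v a ∧ v (.box m a) ∧ ∀ b, w (.box m b) → v b := by
  have h1 : ¬ w (.box m (.imp (.box m a) a)) := by
    have := hw.2 _ (.lob m a hm)
    rw [hw.1.2] at this
    tauto
  obtain ⟨v, hv, hn, hs⟩ := hw.exists_succ hm h1
  rw [hv.1.2] at hn
  exact ⟨v, hv, by tauto, by tauto, hs⟩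

theorem IsPoint.box_box {w : MF → Prop} (hw : IsPoint R l w) {m : ℕ} (hm : m ∈ l) {a : MF}
    (ha : w (.box m a)) : w (.box m (.box m a)) := by
  let c : MF := .neg (.imp a (.neg (.box m a)))
  have hc : ∀ v, IsPoint R l v → (v c ↔ (v a ∧ v (.box m a))) := by
    intro v hv
    simp only [c, hv.1.neg, hv.1.2]; tauto
  by_contra h
  have h1 : ¬ w (.box m c) := fun h1 =>
    h (hw.box_of_forall hm fun v hv hs => ((hc v hv).1 (hs _ h1)).2)
  obtain ⟨v, hv, hn, hb, hs⟩ := hw.exists_succ_box hm h1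
  exact hn ((hc v hv).2 ⟨hs _ ha,
    hv.box_of_forall hm fun u hu hsu => ((hc u hu).1 (hsu _ hb)).1⟩)

theorem IsPoint.box_mono {w : MF → Prop} (hw : IsPoint R l w) {m n : ℕ} (hm : m ∈ l) (hn : n ∈ l)
    (h : R m n) {a : MF} (ha : w (.box m a)) : w (.box n a) := by
  have h1 := hw.2 _ (.mono (.neg a) hm hn h)
  simp only [MF.dia, hw.1.2, hw.1.neg] at h1
  have h2 : w (.box m a.neg.neg) :=
    hw.box_of_forall hm fun v hv hs => by simpa [hv.1.neg] using hs _ ha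
  by_contra h3
  refine h1 (fun h4 => h3 ?_) h2
  exact hw.box_of_forall hn fun v hv hs => by simpa [hv.1.neg] using hs _ h4

theorem IsPoint.box_neg_box {w : MF → Prop} (hw : IsPoint R l w) {m n : ℕ} (hm : m ∈ l)
    (hn : n ∈ l) (h : R m n) {a : MF} (ha : ¬ w (.box m a)) : w (.box n (.neg (.box m a))) := by
  have h1 := hw.2 _ (.stab (.neg a) hm hn h)
  simp only [MF.dia, hw.1.2, hw.1.neg] at h1
  have h2 : ¬ w (.box m a.neg.neg) := fun h3 =>
    ha (hw.box_of_forall hm fun v hv hs => by simpa [hv.1.neg] using hs _ h3)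
  refine hw.box_of_forall hn fun v hv hs => ?_
  have h3 := hs _ (h1 h2)
  rw [hv.1.neg] at h3 ⊢
  exact fun h4 => h3 (hv.box_of_forall hm fun u hu hsu => by simpa [hu.1.neg] using hsu _ h4)

theorem IsPoint.box_box_of_rel {w : MF → Prop} (hw : IsPoint R l w) {m n : ℕ} (hm : m ∈ l)
    (hn : n ∈ l) (h : R m n) {a : MF} (ha : w (.box m a)) : w (.box n (.box m a)) :=
  hw.box_mono hm hn h (hw.box_box hm ha)

end Canonical

/-! ### The least modality of a list -/

/-- `[m]a` for the first modality `m` of the list, and a tautology if the list is empty. -/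
def headBox : List ℕ → MF → MF
  | [], _ => .neg .bot
  | m :: _, a => .box m a

section HeadBox

variable {R : ℕ → ℕ → Prop} {l : List ℕ}

theorem IsPoint.headBox_box (hl : l.Pairwise R) {w : MF → Prop} (hw : IsPoint R l w) {n : ℕ}
    (hn : n ∈ l) {a : MF} (ha : w (headBox l a)) : w (.box n a) := by
  cases l with
  | nil => simp at hn
  | cons m l =>
    rcases List.mem_cons.1 hn with rfl | h
    · exact ha
    · exact hw.box_mono (by simp) hn ((List.pairwise_cons.1 hl).1 n h) ha

theorem IsPoint.box_headBox (hl : l.Pairwise R) {w : MF → Prop} (hw : IsPoint R l w) {n : ℕ}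
    (hn : n ∈ l) {a : MF} (ha : w (headBox l a)) : w (.box n (headBox l a)) := by
  cases l with
  | nil => simp at hn
  | cons m l =>
    rcases List.mem_cons.1 hn with rfl | h
    · exact hw.box_box hn ha
    · exact hw.box_box_of_rel (by simp) hn ((List.pairwise_cons.1 hl).1 n h) ha

theorem IsPoint.exists_succ_headBox {w : MF → Prop} (hw : IsPoint R l w) {a : MF}
    (ha : ¬ w (headBox l a)) :
    ∃ v, IsPoint R l v ∧ ¬ v a ∧ v (headBox l a) ∧
      ∀ b, w (headBox l b) → v b ∧ v (headBox l b) := by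
  cases l with
  | nil => simp [headBox, hw.1.neg, hw.1.1] at ha
  | cons m l =>
    obtain ⟨v, hv, h1, h2, h3⟩ := hw.exists_succ_box (by simp) ha
    exact ⟨v, hv, h1, h2, fun b hb => ⟨h3 _ hb, h3 _ (hw.box_box (by simp) hb)⟩⟩

theorem IsPoint.headBox_of_forall {w : MF → Prop} (hw : IsPoint R l w) {a : MF}
    (h : ∀ v, IsPoint R l v → (∀ b, w (headBox l b) → v b) → v a) : w (headBox l a) := by
  by_contra ha
  obtain ⟨v, hv, hn, -, hs⟩ := hw.exists_succ_headBox ha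
  exact hn (h v hv fun b hb => (hs b hb).1)

end HeadBox

/-! ### Evaluating the boxes of one modality -/

noncomputable instance : DecidableEq MF := Classical.decEq MF

/-- Replace each outermost `[b]a` by a truth value, according to whether `a ∈ s`. -/
noncomputable def evalBox (b : ℕ) (s : Finset MF) : MF → MF
  | .var p => .var p
  | .bot => .bot
  | .imp a c => .imp (evalBox b s a) (evalBox b s c)
  | .box n a => if n = b then (if a ∈ s then .neg .bot else .bot) else .box n (evalBox b s a)

/-- The formulas `a` for which `[b]a` is a subformula. -/
noncomputable def boxedBy (b : ℕ) : MF → Finset MF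
  | .var _ => ∅
  | .bot => ∅
  | .imp a c => boxedBy b a ∪ boxedBy b c
  | .box n a => if n = b then insert a (boxedBy b a) else boxedBy b a

/-- All modalities of the formula are in the list. -/
def ModsIn (l : List ℕ) : MF → Prop
  | .var _ => True
  | .bot => True
  | .imp a c => ModsIn l a ∧ ModsIn l c
  | .box n a => n ∈ l ∧ ModsIn l a

theorem ModsIn.weaken {l l' : List ℕ} (h : ∀ x ∈ l, x ∈ l') {a : MF} (ha : ModsIn l a) :
    ModsIn l' a := by
  induction a with
  | var => trivial
  | bot => trivial
  | imp a c ia ic => exact ⟨ia ha.1, ic ha.2⟩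
  | box n a ia => exact ⟨h _ ha.1, ia ha.2⟩

theorem ModsIn.evalBox {b : ℕ} {l : List ℕ} {a : MF} (ha : ModsIn (b :: l) a) (s : Finset MF) :
    ModsIn l (evalBox b s a) := by
  induction a with
  | var => trivial
  | bot => trivial
  | imp a c ia ic => exact ⟨ia ha.1, ic ha.2⟩
  | box n a ia =>
    unfold SOA.evalBox
    split_ifs with h1 h2
    · exact ⟨trivial, trivial⟩
    · trivial
    · exact ⟨(List.mem_cons.1 ha.1).resolve_left h1, ia ha.2⟩

theorem ModsIn.of_mem_boxedBy {b : ℕ} {l : List ℕ} {a c : MF} (ha : ModsIn l a)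
    (hc : c ∈ boxedBy b a) : ModsIn l c := by
  induction a with
  | var => simp [boxedBy] at hc
  | bot => simp [boxedBy] at hc
  | imp a d ia id =>
    rcases Finset.mem_union.1 hc with h | h
    exacts [ia ha.1 h, id ha.2 h]
  | box n a ia =>
    unfold boxedBy at hc
    split_ifs at hc
    · rcases Finset.mem_insert.1 hc with rfl | h
      exacts [ha.2, ia ha.2 h]
    · exact ia ha.2 hc

theorem boxedBy_eq_empty {b : ℕ} {l : List ℕ} (hb : b ∉ l) {a : MF} (ha : ModsIn l a) :
    boxedBy b a = ∅ := by
  induction a with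
  | var => rfl
  | bot => rfl
  | imp a c ia ic => simp [boxedBy, ia ha.1, ic ha.2]
  | box n a ia =>
    have : n ≠ b := fun h => hb (h ▸ ha.1)
    simp [boxedBy, this, ia ha.2]

theorem evalBox_eq_self {b : ℕ} {l : List ℕ} (hb : b ∉ l) {a : MF} (ha : ModsIn l a)
    (s : Finset MF) : evalBox b s a = a := by
  induction a with
  | var => rfl
  | bot => rfl
  | imp a c ia ic => simp [evalBox, ia ha.1, ic ha.2]
  | box n a ia =>
    have : n ≠ b := fun h => hb (h ▸ ha.1)
    simp [evalBox, this, ia ha.2]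

theorem boxedBy_subset {b : ℕ} {a c : MF} (hc : c ∈ boxedBy b a) :
    boxedBy b c ⊆ boxedBy b a := by
  induction a with
  | var => simp [boxedBy] at hc
  | bot => simp [boxedBy] at hc
  | imp a d ia id =>
    rcases Finset.mem_union.1 hc with h | h
    · exact (ia h).trans Finset.subset_union_left
    · exact (id h).trans Finset.subset_union_right
  | box n a ia =>
    unfold boxedBy at hc
    rw [boxedBy]
    split_ifs at hc ⊢
    · rcases Finset.mem_insert.1 hc with rfl | h
      · exact Finset.subset_insert _ _
      · exact (ia h).trans (Finset.subset_insert _ _)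
    · exact ia hc

theorem sizeOf_lt_of_mem_boxedBy {b : ℕ} {a c : MF} (hc : c ∈ boxedBy b a) :
    sizeOf c < sizeOf a := by
  induction a with
  | var => simp [boxedBy] at hc
  | bot => simp [boxedBy] at hc
  | imp a d ia id =>
    rw [MF.imp.sizeOf_spec]
    rcases Finset.mem_union.1 hc with h | h
    · have := ia h; omega
    · have := id h; omega
  | box n a ia =>
    rw [MF.box.sizeOf_spec]
    unfold boxedBy at hc
    split_ifs at hc
    · rcases Finset.mem_insert.1 hc with rfl | h
      · omega
      · have := ia h; omega
    · have := ia hc; omega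

theorem evalBox_congr {b : ℕ} {s t : Finset MF} {a : MF}
    (h : ∀ c ∈ boxedBy b a, (c ∈ s ↔ c ∈ t)) : evalBox b s a = evalBox b t a := by
  induction a with
  | var => rfl
  | bot => rfl
  | imp a c ia ic =>
    rw [evalBox, evalBox, ia fun d hd => h d (Finset.mem_union_left _ hd),
      ic fun d hd => h d (Finset.mem_union_right _ hd)]
  | box n a ia =>
    unfold boxedBy at h
    rw [evalBox, evalBox]
    split_ifs at h with hn
    · simp only [hn, if_true, h a (Finset.mem_insert_self _ _)]
    · rw [ia h, if_neg hn, if_neg hn]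

theorem IsVal.evalBox {w : MF → Prop} (hw : IsVal w) (b : ℕ) (s : Finset MF) :
    IsVal fun a => w (evalBox b s a) :=
  ⟨hw.1, fun _ _ => hw.2 _ _⟩

theorem IsVal.evalBox_box {w : MF → Prop} (hw : IsVal w) (b : ℕ) (s : Finset MF) (a : MF) :
    w (SOA.evalBox b s (.box b a)) ↔ a ∈ s := by
  simp only [SOA.evalBox, if_true]
  split_ifs with h <;> simp [h, hw.neg, hw.1]

/-! ### Realizable sets of boxed formulas -/

/-- The least modality of `l` preserves the members of `s`, as evaluated by `s` itself. -/
def Monotone₁ (b : ℕ) (l : List ℕ) (s : Finset MF) (w : MF → Prop) : Prop :=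
  ∀ c ∈ s, w (headBox l (evalBox b s c))

/-- `s` can be the set of those `a ∈ Φ` for which `[b]a` is true, where `b` is a new modality
below those of `l`: each failure of `[b]a` is witnessed further down. -/
inductive Realizable (R : ℕ → ℕ → Prop) (b : ℕ) (l : List ℕ) (Φ : Finset MF) : Finset MF → Prop
  | mk (s : Finset MF) (hs : s ⊆ Φ) (f : MF → Finset MF)
      (hf : ∀ a ∈ Φ, a ∉ s → s ⊆ f a ∧ a ∈ f a)
      (hr : ∀ a ∈ Φ, a ∉ s → Realizable R b l Φ (f a))
      (hw : ∀ a ∈ Φ, a ∉ s → ∃ w, IsPoint R l w ∧ Monotone₁ b l (f a) w ∧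
        (∀ c ∈ s, w (evalBox b (f a) c)) ∧ ¬ w (evalBox b (f a) a)) :
      Realizable R b l Φ s

/-- `Φ` is closed under taking formulas boxed by `b` in subformulas. -/
def BoxClosed (b : ℕ) (Φ : Finset MF) : Prop := ∀ a ∈ Φ, boxedBy b a ⊆ Φ

section Realizable

variable {R : ℕ → ℕ → Prop} {b : ℕ} {l : List ℕ} {Φ : Finset MF}

theorem Realizable.subset {s : Finset MF} (h : Realizable R b l Φ s) : s ⊆ Φ := by
  cases h; assumption

theorem Realizable.exists_witness {s : Finset MF} (h : Realizable R b l Φ s) {a : MF}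
    (ha : a ∈ Φ) (has : a ∉ s) : ∃ t, Realizable R b l Φ t ∧ s ⊆ t ∧ a ∈ t ∧
      ∃ w, IsPoint R l w ∧ Monotone₁ b l t w ∧ (∀ c ∈ s, w (evalBox b t c)) ∧
        ¬ w (evalBox b t a) := by
  cases h with
  | mk _ hs f hf hr hw => exact ⟨f a, hr a ha has, (hf a ha has).1, (hf a ha has).2, hw a ha has⟩

theorem Realizable.of_exists {s : Finset MF} (hs : s ⊆ Φ)
    (h : ∀ a ∈ Φ, a ∉ s → ∃ t, Realizable R b l Φ t ∧ s ⊆ t ∧ a ∈ t ∧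
      ∃ w, IsPoint R l w ∧ Monotone₁ b l t w ∧ (∀ c ∈ s, w (evalBox b t c)) ∧
        ¬ w (evalBox b t a)) : Realizable R b l Φ s := by
  choose! f hf using h
  exact .mk s hs f (fun a ha has => ⟨(hf a ha has).2.1, (hf a ha has).2.2.1⟩)
    (fun a ha has => (hf a ha has).1) (fun a ha has => (hf a ha has).2.2.2)

/-- Realizable sets extend along the addition of one formula. -/
theorem Realizable.extend_insert (hΦ : BoxClosed b Φ) {d : MF} (hd : d ∉ Φ) {s : Finset MF}
    (h : Realizable R b l Φ s) : ∃ t, Realizable R b l (insert d Φ) t ∧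
      (∀ c ∈ Φ, (c ∈ t ↔ c ∈ s)) ∧ ∀ w, IsPoint R l w → Monotone₁ b l s w → Monotone₁ b l t w := by
  induction h with
  | mk s hs f hf hr hw ih =>
    have ev : ∀ t t' : Finset MF, (∀ c ∈ Φ, (c ∈ t ↔ c ∈ t')) → ∀ c ∈ Φ,
        evalBox b t c = evalBox b t' c := fun t t' h c hc =>
      evalBox_congr fun e he => h e (hΦ c hc he)
    have hsd : s ⊆ insert d Φ := hs.trans (Finset.subset_insert _ _)
    have W : ∀ a ∈ Φ, a ∉ s → ∃ t, Realizable R b l (insert d Φ) t ∧ s ⊆ t ∧ a ∈ t ∧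
        ∃ w, IsPoint R l w ∧ Monotone₁ b l t w ∧ (∀ c ∈ s, w (evalBox b t c)) ∧
          ¬ w (evalBox b t a) := by
      intro a ha has
      obtain ⟨t, ht, hts, htm⟩ := ih a ha has
      obtain ⟨w, hwp, hwm, hwc, hwa⟩ := hw a ha has
      obtain ⟨h1, h2⟩ := hf a ha has
      refine ⟨t, ht, fun c hc => (hts c (hs hc)).2 (h1 hc), (hts a ha).2 h2, w, hwp,
        htm w hwp hwm, fun c hc => ?_, ?_⟩
      · rw [ev t (f a) hts c (hs hc)]; exact hwc c hc
      · rw [ev t (f a) hts a ha]; exact hwa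
    have fallback : (∃ t, Realizable R b l (insert d Φ) t ∧ s ⊆ t ∧ d ∈ t ∧
        ∃ w, IsPoint R l w ∧ Monotone₁ b l t w ∧ (∀ c ∈ s, w (evalBox b t c)) ∧
          ¬ w (evalBox b t d)) → Realizable R b l (insert d Φ) s := by
      intro hdw
      refine .of_exists hsd fun a ha has => ?_
      rcases Finset.mem_insert.1 ha with rfl | ha
      exacts [hdw, W a ha has]
    by_cases ok : ∀ a ∈ Φ, a ∉ s → ∃ t, Realizable R b l (insert d Φ) t ∧ insert d s ⊆ t ∧
        a ∈ t ∧ ∃ w, IsPoint R l w ∧ Monotone₁ b l t w ∧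
          (∀ c ∈ insert d s, w (evalBox b t c)) ∧ ¬ w (evalBox b t a)
    · have hr1 : Realizable R b l (insert d Φ) (insert d s) := by
        refine .of_exists (Finset.insert_subset_insert _ hs) fun a ha has => ?_
        rw [Finset.mem_insert, not_or] at has
        exact ok a ((Finset.mem_insert.1 ha).resolve_left has.1) has.2
      have hds : ∀ c ∈ Φ, (c ∈ insert d s ↔ c ∈ s) := by
        intro c hc
        have : c ≠ d := fun h => hd (h ▸ hc)
        simp [this]
      by_cases hall : ∀ w, IsPoint R l w → Monotone₁ b l s w →
          w (headBox l (evalBox b (insert d s) d))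
      · refine ⟨insert d s, hr1, hds, fun w hwp hwm c hc => ?_⟩
        rcases Finset.mem_insert.1 hc with rfl | hc
        · exact hall w hwp hwm
        · rw [ev _ s hds c (hs hc)]; exact hwm c hc
      · push Not at hall
        obtain ⟨w, hwp, hwm, hwd⟩ := hall
        obtain ⟨v, hv, h1, h2, h3⟩ := hwp.exists_succ_headBox hwd
        refine ⟨s, fallback ⟨insert d s, hr1, Finset.subset_insert _ _,
          Finset.mem_insert_self _ _, v, hv, fun c hc => ?_, fun c hc => ?_, h1⟩,
          fun _ _ => Iff.rfl, fun _ _ h => h⟩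
        · rcases Finset.mem_insert.1 hc with rfl | hc
          · exact h2
          · rw [ev _ s hds c (hs hc)]; exact (h3 _ (hwm c hc)).2
        · rw [ev _ s hds c (hs hc)]; exact (h3 _ (hwm c hc)).1
    · push Not at ok
      obtain ⟨a, ha, has, hbad⟩ := ok
      refine ⟨s, fallback ?_, fun _ _ => Iff.rfl, fun _ _ h => h⟩
      obtain ⟨t, ht, hst, hat, w, hwp, hwm, hwc, hwa⟩ := W a ha has
      by_cases hdt : d ∈ t
      · refine ⟨t, ht, hst, hdt, w, hwp, hwm, hwc, fun hwd => ?_⟩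
        refine hwa (hbad t ht (Finset.insert_subset hdt hst) hat w hwp hwm fun c hc => ?_)
        rcases Finset.mem_insert.1 hc with rfl | hc
        exacts [hwd, hwc c hc]
      · obtain ⟨u, hu, htu, hdu, v, hv, h1, h2, h3⟩ :=
          ht.exists_witness (Finset.mem_insert_self _ _) hdt
        exact ⟨u, hu, hst.trans htu, hdu, v, hv, h1, fun c hc => h2 c (hst hc), h3⟩

theorem Realizable.extend {Ψ : Finset MF} (hΦ : BoxClosed b Φ) (hΨ : BoxClosed b Ψ) (hΦΨ : Φ ⊆ Ψ)
    {s : Finset MF} (h : Realizable R b l Φ s) : ∃ t, Realizable R b l Ψ t ∧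
      (∀ c ∈ Φ, (c ∈ t ↔ c ∈ s)) ∧ ∀ w, IsPoint R l w → Monotone₁ b l s w → Monotone₁ b l t w := by
  induction hn : (Ψ \ Φ).card generalizing Φ s with
  | zero =>
    have : Φ = Ψ := hΦΨ.antisymm (by simpa using hn)
    subst this
    exact ⟨s, h, fun _ _ => Iff.rfl, fun _ _ h => h⟩
  | succ n ih =>
    obtain ⟨d, hd, hmin⟩ := (Ψ \ Φ).exists_min_image (fun a => sizeOf a)
      (Finset.card_pos.1 (by omega))
    rw [Finset.mem_sdiff] at hd
    have hd' : boxedBy b d ⊆ Φ := by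
      intro c hc
      by_contra hcΦ
      have h1 := hmin c (Finset.mem_sdiff.2 ⟨hΨ d hd.1 hc, hcΦ⟩)
      have h2 := sizeOf_lt_of_mem_boxedBy hc
      omega
    obtain ⟨t, ht, hts, htm⟩ := h.extend_insert hΦ hd.2
    have hcl : BoxClosed b (insert d Φ) := by
      intro a ha
      refine Finset.Subset.trans ?_ (Finset.subset_insert _ _)
      rcases Finset.mem_insert.1 ha with rfl | ha
      exacts [hd', hΦ a ha]
    have hcard : (Ψ \ insert d Φ).card = n := by
      rw [Finset.sdiff_insert, Finset.card_erase_of_mem (Finset.mem_sdiff.2 hd), hn]; rfl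
    obtain ⟨u, hu, hut, hum⟩ := ih hcl (Finset.insert_subset hd.1 hΦΨ) ht hcard
    exact ⟨u, hu, fun c hc => (hut c (Finset.mem_insert_of_mem hc)).trans (hts c hc),
      fun w hwp hwm => hum w hwp (htm w hwp hwm)⟩

theorem exists_boxClosed (b : ℕ) (Φ : Finset MF) : ∃ Ψ, Φ ⊆ Ψ ∧ BoxClosed b Ψ := by
  refine ⟨Φ ∪ Φ.biUnion (boxedBy b), Finset.subset_union_left, fun a ha => ?_⟩
  refine Finset.Subset.trans ?_ Finset.subset_union_right
  rcases Finset.mem_union.1 ha with h | h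
  · exact Finset.subset_biUnion_of_mem (boxedBy b) h
  · obtain ⟨c, hc, hac⟩ := Finset.mem_biUnion.1 h
    exact (boxedBy_subset hac).trans (Finset.subset_biUnion_of_mem (boxedBy b) hc)

/-! ### Soundness and completeness of realizable sets -/

theorem GLPOn.exists_sound [IsStrictOrder ℕ R] (hl : (b :: l).Pairwise R) {φ : MF}
    (h : GLPOn R (b :: l) φ) : ∃ Φ₀ : Finset MF, ∀ Φ, Φ₀ ⊆ Φ → ∀ s, Realizable R b l Φ s →
      ∀ w, IsPoint R l w → Monotone₁ b l s w → w (evalBox b s φ) := by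
  obtain ⟨hbl, hl'⟩ := List.pairwise_cons.1 hl
  have hne : ∀ n ∈ l, n ≠ b := fun n hn h => irrefl_of R b (h ▸ hbl n hn)
  induction h with
  | taut ha => exact ⟨∅, fun Φ _ s _ w hw _ => ha (fun a => w (evalBox b s a))
      (hw.1.evalBox b s).1 (hw.1.evalBox b s).2⟩
  | k n a c hn =>
    rcases List.mem_cons.1 hn with rfl | hn
    · refine ⟨{c}, fun Φ hΦ s hs w hw _ => ?_⟩
      simp only [evalBox.eq_3, hw.1.2, hw.1.evalBox_box]
      intro h1 h2
      by_contra h3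
      obtain ⟨t, -, -, -, v, hv, -, h4, h5⟩ := hs.exists_witness (hΦ (by simp)) h3
      have h6 := h4 _ h1
      rw [evalBox, hv.1.2] at h6
      exact h5 (h6 (h4 _ h2))
    · refine ⟨∅, fun Φ _ s _ w hw _ => ?_⟩
      simp only [evalBox, hne n hn, if_false]
      exact hw.2 _ (.k n _ _ hn)
  | lob n a hn =>
    rcases List.mem_cons.1 hn with rfl | hn
    · refine ⟨{a}, fun Φ hΦ s hs w hw _ => ?_⟩
      rw [evalBox.eq_3, hw.1.2, hw.1.evalBox_box, hw.1.evalBox_box]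
      intro h1
      by_contra h3
      obtain ⟨t, -, -, hat, v, hv, -, h4, h5⟩ := hs.exists_witness (hΦ (by simp)) h3
      have h6 := h4 _ h1
      rw [evalBox.eq_3, hv.1.2, hv.1.evalBox_box] at h6
      exact h5 (h6 hat)
    · refine ⟨∅, fun Φ _ s _ w hw _ => ?_⟩
      simp only [evalBox, hne n hn, if_false]
      exact hw.2 _ (.lob n _ hn)
  | @mono ξ ζ a hξ hζ hR =>
    have hζl : ζ ∈ l := by
      refine (List.mem_cons.1 hζ).resolve_left ?_
      rintro rfl
      rcases List.mem_cons.1 hξ with rfl | hξ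
      · exact irrefl_of R _ hR
      · exact irrefl_of R _ (trans_of R hR (hbl _ hξ))
    rcases List.mem_cons.1 hξ with rfl | hξ
    · refine ⟨∅, fun Φ hΦ s hs w hw hm => ?_⟩
      simp only [MF.dia, MF.neg, evalBox.eq_3, hw.1.2, hw.1.evalBox_box]
      intro h1 h2
      have h3 := hw.headBox_box hl' hζl (hm _ h2)
      simp only [evalBox, hne ζ hζl, if_false] at h1 h3
      exact (hw.1.1 (h1 h3)).elim
    · refine ⟨∅, fun Φ _ s _ w hw _ => ?_⟩
      simp only [MF.dia, MF.neg, evalBox, hne ξ hξ, hne ζ hζl, if_false]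
      exact hw.2 _ (.mono _ hξ hζl hR)
  | @stab ξ ζ a hξ hζ hR =>
    have hζl : ζ ∈ l := by
      refine (List.mem_cons.1 hζ).resolve_left ?_
      rintro rfl
      rcases List.mem_cons.1 hξ with rfl | hξ
      · exact irrefl_of R _ hR
      · exact irrefl_of R _ (trans_of R hR (hbl _ hξ))
    refine ⟨∅, fun Φ hΦ s hs w hw hm => ?_⟩
    rcases List.mem_cons.1 hξ with rfl | hξ
    · have h0 : ∀ v, IsVal v → (v (evalBox ξ s (MF.dia ξ a)) ↔ a.neg ∉ s) := by
        intro v hv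
        rw [MF.dia, MF.neg, evalBox.eq_3, hv.2, hv.evalBox_box]
        simp [evalBox, hv.1]
      rw [evalBox.eq_3, hw.1.2, h0 w hw.1, evalBox.eq_4, if_neg (hne ζ hζl)]
      exact fun h1 => hw.box_of_forall hζl fun v hv _ => (h0 v hv.1).2 h1
    · simp only [MF.dia, MF.neg, evalBox, hne ξ hξ, hne ζ hζl, if_false]
      exact hw.2 _ (.stab _ hξ hζl hR)
  | mp _ _ i1 i2 =>
    obtain ⟨Φ₁, h1⟩ := i1
    obtain ⟨Φ₂, h2⟩ := i2
    refine ⟨Φ₁ ∪ Φ₂, fun Φ hΦ s hs w hw hm => ?_⟩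
    have h3 := h1 Φ (Finset.subset_union_left.trans hΦ) s hs w hw hm
    rw [evalBox, hw.1.2] at h3
    exact h3 (h2 Φ (Finset.subset_union_right.trans hΦ) s hs w hw hm)
  | @nec a n hn _ i =>
    obtain ⟨Φ₀, h0⟩ := i
    refine ⟨insert a Φ₀, fun Φ hΦ s hs w hw hm => ?_⟩
    have h1 := h0 Φ ((Finset.subset_insert _ _).trans hΦ)
    rcases List.mem_cons.1 hn with rfl | hn
    · rw [hw.1.evalBox_box]
      by_contra h3
      obtain ⟨t, ht, -, hat, v, hv, hvm, h4, h5⟩ :=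
        hs.exists_witness (hΦ (Finset.mem_insert_self _ _)) h3
      exact h5 (h1 t ht v hv hvm)
    · rw [evalBox, if_neg (hne n hn)]
      exact hw.box_of_forall hn fun v hv hvs =>
        h1 s hs v hv fun c hc => hvs _ (hw.box_headBox hl' hn (hm c hc))

theorem GLPOn.sound [IsStrictOrder ℕ R] (hl : (b :: l).Pairwise R) {φ : MF}
    (h : GLPOn R (b :: l) φ) (hΦ : BoxClosed b Φ) (hφ : boxedBy b φ ⊆ Φ) {s : Finset MF}
    (hs : Realizable R b l Φ s) {w : MF → Prop} (hw : IsPoint R l w) (hm : Monotone₁ b l s w) :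
    w (evalBox b s φ) := by
  obtain ⟨Φ₀, h0⟩ := h.exists_sound hl
  obtain ⟨Ψ, hΨ, hcl⟩ := exists_boxClosed b (Φ₀ ∪ Φ)
  obtain ⟨t, ht, hts, htm⟩ := hs.extend hΦ hcl (Finset.subset_union_right.trans hΨ)
  rw [evalBox_congr fun c hc => (hts c (hφ hc)).symm]
  exact h0 Ψ (Finset.subset_union_left.trans hΨ) t ht w hw (htm w hw hm)

open Classical in
/-- The members of `Φ` that are `b`-boxed at `w`. -/
noncomputable def trueBoxes (b : ℕ) (Φ : Finset MF) (w : MF → Prop) : Finset MF :=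
  Φ.filter fun a => w (.box b a)

theorem mem_trueBoxes {w : MF → Prop} {a : MF} :
    a ∈ trueBoxes b Φ w ↔ a ∈ Φ ∧ w (.box b a) := by
  simp [trueBoxes]

theorem IsPoint.trueBoxes_succ (hl : (b :: l).Pairwise R) {w v : MF → Prop}
    (hw : IsPoint R (b :: l) w) (hv : IsPoint R (b :: l) v) {m : ℕ} (hm : m ∈ l)
    (hs : ∀ a, w (.box m a) → v a) : trueBoxes b Φ v = trueBoxes b Φ w := by
  have hR := (List.pairwise_cons.1 hl).1 m hm
  ext a
  rw [mem_trueBoxes, mem_trueBoxes]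
  refine and_congr_right fun _ => ⟨fun h => ?_, fun h =>
    hs _ (hw.box_box_of_rel (by simp) (by simp [hm]) hR h)⟩
  by_contra h1
  exact (hv.1.neg _).1 (hs _ (hw.box_neg_box (by simp) (by simp [hm]) hR h1)) h

theorem IsPoint.evalBox_trueBoxes (hl : (b :: l).Pairwise R) {a : MF} (ha : ModsIn (b :: l) a)
    (haΦ : boxedBy b a ⊆ Φ) {w : MF → Prop} (hw : IsPoint R (b :: l) w) :
    w (evalBox b (trueBoxes b Φ w) a) ↔ w a := by
  induction a generalizing w with
  | var => rfl
  | bot => rfl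
  | imp a c ia ic =>
    rw [boxedBy, Finset.union_subset_iff] at haΦ
    rw [evalBox, hw.1.2, hw.1.2, ia ha.1 haΦ.1 hw, ic ha.2 haΦ.2 hw]
  | box n a ia =>
    by_cases hn : n = b
    · subst hn
      rw [boxedBy, if_pos rfl, Finset.insert_subset_iff] at haΦ
      rw [hw.1.evalBox_box, mem_trueBoxes]
      simp [haΦ.1]
    · rw [boxedBy, if_neg hn] at haΦ
      rw [evalBox, if_neg hn]
      have hnl : n ∈ l := (List.mem_cons.1 ha.1).resolve_left hn
      constructor <;> refine fun h => hw.box_of_forall ha.1 fun v hv hs => ?_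
      · rw [← ia ha.2 haΦ hv, hw.trueBoxes_succ hl hv hnl hs]
        exact hs _ h
      · rw [← hw.trueBoxes_succ hl hv hnl hs, ia ha.2 haΦ hv]
        exact hs _ h

theorem IsPoint.tail {w : MF → Prop} (hw : IsPoint R (b :: l) w) : IsPoint R l w :=
  ⟨hw.1, fun a ha => hw.2 a (ha.weaken fun _ h => List.mem_cons_of_mem _ h)⟩

theorem IsPoint.monotone₁_trueBoxes (hl : (b :: l).Pairwise R) (hΦ : BoxClosed b Φ)
    (hmods : ∀ a ∈ Φ, ModsIn (b :: l) a) {w : MF → Prop} (hw : IsPoint R (b :: l) w) :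
    Monotone₁ b l (trueBoxes b Φ w) w := by
  intro c hc
  rw [mem_trueBoxes] at hc
  cases l with
  | nil => simp [headBox, hw.1.neg, hw.1.1]
  | cons m l =>
    have hR := (List.pairwise_cons.1 hl).1 m (by simp)
    have h1 : w (.box m c) := hw.box_mono (by simp) (by simp) hR hc.2
    refine hw.box_of_forall (by simp) fun v hv hs => ?_
    rw [← hw.trueBoxes_succ hl hv (m := m) (by simp) hs,
      hv.evalBox_trueBoxes hl (hmods c hc.1) (hΦ c hc.1)]
    exact hs _ h1

theorem IsPoint.realizable_trueBoxes (hl : (b :: l).Pairwise R) (hΦ : BoxClosed b Φ)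
    (hmods : ∀ a ∈ Φ, ModsIn (b :: l) a) {w : MF → Prop} (hw : IsPoint R (b :: l) w) :
    Realizable R b l Φ (trueBoxes b Φ w) := by
  induction hn : (Φ \ trueBoxes b Φ w).card using Nat.strong_induction_on generalizing w with
  | _ n ih =>
    refine .of_exists (fun a ha => (mem_trueBoxes.1 ha).1) fun a ha has => ?_
    have hwa : ¬ w (.box b a) := fun h => has (mem_trueBoxes.2 ⟨ha, h⟩)
    obtain ⟨v, hv, h1, h2, h3⟩ := hw.exists_succ_box (by simp) hwa
    have hsub : trueBoxes b Φ w ⊆ trueBoxes b Φ v := by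
      intro c hc
      rw [mem_trueBoxes] at hc ⊢
      exact ⟨hc.1, h3 _ (hw.box_box (by simp) hc.2)⟩
    have hav : a ∈ trueBoxes b Φ v := mem_trueBoxes.2 ⟨ha, h2⟩
    refine ⟨trueBoxes b Φ v, ih _ ?_ hv rfl, hsub, hav, v, hv.tail,
      hv.monotone₁_trueBoxes hl hΦ hmods, fun c hc => ?_, ?_⟩
    · rw [← hn]
      refine Finset.card_lt_card ⟨Finset.sdiff_subset_sdiff le_rfl hsub, fun h => ?_⟩
      exact (Finset.mem_sdiff.1 (h (Finset.mem_sdiff.2 ⟨ha, has⟩))).2 hav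
    · rw [mem_trueBoxes] at hc
      rw [hv.evalBox_trueBoxes hl (hmods c hc.1) (hΦ c hc.1)]
      exact h3 _ hc.2
    · rwa [hv.evalBox_trueBoxes hl (hmods a ha) (hΦ a ha)]

theorem glpOn_of_realizable (hl : (b :: l).Pairwise R) (hΦ : BoxClosed b Φ)
    (hmods : ∀ a ∈ Φ, ModsIn (b :: l) a) {φ : MF} (hφm : ModsIn (b :: l) φ)
    (hφ : boxedBy b φ ⊆ Φ) (h : ∀ s, Realizable R b l Φ s → ∀ w, IsPoint R l w →
      Monotone₁ b l s w → w (evalBox b s φ)) : GLPOn R (b :: l) φ := by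
  rw [glpOn_iff_forall_point]
  intro w hw
  rw [← hw.evalBox_trueBoxes hl hφm hφ]
  exact h _ (hw.realizable_trueBoxes hl hΦ hmods) w hw.tail (hw.monotone₁_trueBoxes hl hΦ hmods)

end Realizable

/-! ### Elimination of unused modalities -/

/-- Conjunction of a list of formulas. -/
def conj : List MF → MF
  | [] => .neg .bot
  | a :: L => .neg (.imp a (.neg (conj L)))

theorem IsVal.conj {w : MF → Prop} (hw : IsVal w) (L : List MF) :
    w (conj L) ↔ ∀ a ∈ L, w a := by
  induction L with
  | nil => simp [SOA.conj, hw.neg, hw.1]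
  | cons a L ih => simp only [SOA.conj, hw.neg, hw.2, ih, List.forall_mem_cons]; tauto

theorem modsIn_conj {l : List ℕ} {L : List MF} (h : ∀ a ∈ L, ModsIn l a) : ModsIn l (conj L) := by
  induction L with
  | nil => exact ⟨trivial, trivial⟩
  | cons a L ih =>
    rw [List.forall_mem_cons] at h
    exact ⟨⟨h.1, ih h.2, trivial⟩, trivial⟩

section Elimination

variable {R : ℕ → ℕ → Prop}

theorem IsPoint.headBox_conj {l : List ℕ} {w : MF → Prop} (hw : IsPoint R l w) (L : List MF) :
    w (headBox l (conj L)) ↔ ∀ a ∈ L, w (headBox l a) := by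
  constructor
  · exact fun h a ha => hw.headBox_of_forall fun v hv hs => (hv.1.conj L).1 (hs _ h) a ha
  · exact fun h => hw.headBox_of_forall fun v hv hs => (hv.1.conj L).2 fun a ha => hs _ (h a ha)

/-- Consequence from finitely many premises transfers between calculi as soon as consequence from
one premise under the least modality does. -/
theorem transfer_point {S U : List ℕ}
    (h : ∀ c d, ModsIn S c → ModsIn S d → GLPOn R U (.imp (headBox U c) d) →
      GLPOn R S (.imp (headBox S c) d))
    {X Y : Finset MF} {a : MF} (hX : ∀ c ∈ X, ModsIn S c) (hY : ∀ c ∈ Y, ModsIn S c)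
    (ha : ModsIn S a)
    (hU : ∀ w, IsPoint R U w → (∀ c ∈ X, w (headBox U c)) → (∀ c ∈ Y, w c) → w a)
    {w : MF → Prop} (hw : IsPoint R S w) (hwX : ∀ c ∈ X, w (headBox S c))
    (hwY : ∀ c ∈ Y, w c) : w a := by
  have h1 := h (conj X.toList) (.imp (conj Y.toList) a) (modsIn_conj (by simpa using hX))
    ⟨modsIn_conj (by simpa using hY), ha⟩ (by
      rw [glpOn_iff_forall_point]
      intro v hv
      rw [hv.1.2, hv.1.2, hv.headBox_conj, hv.1.conj]
      simpa using hU v hv)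
  have h2 := hw.2 _ h1
  rw [hw.1.2, hw.1.2, hw.headBox_conj, hw.1.conj] at h2
  exact h2 (by simpa using hwX) (by simpa using hwY)

theorem Realizable.transfer {S U : List ℕ} {b : ℕ}
    (h : ∀ c d, ModsIn S c → ModsIn S d → GLPOn R U (.imp (headBox U c) d) →
      GLPOn R S (.imp (headBox S c) d))
    {Φ : Finset MF} (hΦ : ∀ a ∈ Φ, ModsIn (b :: S) a) {s : Finset MF}
    (hs : Realizable R b S Φ s) : Realizable R b U Φ s := by
  induction hs with
  | mk s hs f hf hr hw ih =>
    refine .mk s hs f hf ih fun a ha has => ?_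
    obtain ⟨w, hwp, hwm, hwc, hwa⟩ := hw a ha has
    by_contra hno
    push Not at hno
    have hfΦ := (hr a ha has).subset
    refine hwa (transfer_point h (X := (f a).image (evalBox b (f a)))
      (Y := s.image (evalBox b (f a))) ?_ ?_ ((hΦ a ha).evalBox _) (fun v hv hX hY => ?_) hwp ?_ ?_)
    · simpa using fun c hc => (hΦ c (hfΦ hc)).evalBox _
    · simpa using fun c hc => (hΦ c (hs hc)).evalBox _
    · exact hno v hv (by simpa [Monotone₁] using hX) (by simpa using hY)
    · simpa [Monotone₁] using hwm
    · simpa using hwc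

theorem GLPOn.eliminate_headBox [IsStrictOrder ℕ R] {S M : List ℕ} (hSM : S.Sublist M)
    (hM : M.Pairwise R) (c d : MF) (hc : ModsIn S c) (hd : ModsIn S d)
    (h : GLPOn R M (.imp (headBox M c) d)) : GLPOn R S (.imp (headBox S c) d) := by
  induction hSM generalizing c d with
  | slnil => exact h
  | @cons S U b hSU ih =>
    have hbl := List.pairwise_cons.1 hM
    refine ih hbl.2 c d hc hd ?_
    have hbS : b ∉ S := fun hb => irrefl_of R b (hbl.1 b (hSU.subset hb))
    rw [glpOn_iff_forall_point]
    intro w hw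
    rw [hw.1.2]
    intro hwc
    have hcl : BoxClosed b {c} := by
      intro a ha
      rw [Finset.mem_singleton.1 ha, boxedBy_eq_empty hbS hc]
      exact Finset.empty_subset _
    have hφ : boxedBy b (.imp (headBox (b :: U) c) d) ⊆ {c} := by
      simp [headBox, boxedBy, boxedBy_eq_empty hbS hc, boxedBy_eq_empty hbS hd]
    have hr : Realizable R b U {c} {c} :=
      .of_exists subset_rfl fun a ha ha' => absurd ha ha'
    have hm : Monotone₁ b U {c} w := by
      intro a ha
      rw [Finset.mem_singleton.1 ha, evalBox_eq_self hbS hc]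
      exact hwc
    have h1 := h.sound hM hcl hφ hr hw hm
    rw [evalBox.eq_3, hw.1.2, headBox, hw.1.evalBox_box, evalBox_eq_self hbS hd] at h1
    exact h1 (Finset.mem_singleton_self c)
  | @cons_cons S U b hSU ih =>
    have hbl := List.pairwise_cons.1 hM
    have ih := ih hbl.2
    have hφm : ModsIn (b :: S) (.imp (headBox (b :: S) c) d) := ⟨⟨by simp, hc⟩, hd⟩
    change GLPOn R (b :: U) (.imp (headBox (b :: S) c) d) at h
    generalize MF.imp (headBox (b :: S) c) d = φ at h hφm ⊢
    have hcl : BoxClosed b (boxedBy b φ) := fun a ha => boxedBy_subset ha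
    have hmods : ∀ a ∈ boxedBy b φ, ModsIn (b :: S) a := fun a ha => hφm.of_mem_boxedBy ha
    refine glpOn_of_realizable (hM.sublist (hSU.cons_cons b)) hcl hmods hφm subset_rfl
      fun s hs w hw hwm => ?_
    refine transfer_point ih (X := s.image (evalBox b s)) (Y := ∅) ?_ (by simp) (hφm.evalBox s)
      (fun v hv hX _ => ?_) hw ?_ (by simp)
    · simpa using fun a ha => (hmods a (hs.subset ha)).evalBox s
    · exact h.sound hM hcl subset_rfl (hs.transfer ih hmods) hv (by simpa [Monotone₁] using hX)
    · simpa [Monotone₁] using hwm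

/-- Modalities that do not occur in a formula are not needed to derive it. -/
theorem GLPOn.eliminate [IsStrictOrder ℕ R] {S M : List ℕ} (hSM : S.Sublist M)
    (hM : M.Pairwise R) {φ : MF} (hφ : ModsIn S φ) (h : GLPOn R M φ) : GLPOn R S φ := by
  have h1 := GLPOn.eliminate_headBox hSM hM (.neg .bot) φ ⟨trivial, trivial⟩ hφ
    (.mp (.taut fun w _ hi => by simp only [hi]; tauto) h)
  rw [glpOn_iff_forall_point] at h1 ⊢
  intro w hw
  have h2 := h1 w hw
  rw [hw.1.2] at h2
  exact h2 (hw.headBox_of_forall fun v hv _ => by simp [hv.1.neg, hv.1.1])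

end Elimination

/-! ### Comparison with `GLP` -/

theorem msub_msub (σ τ : ℕ → MF) (a : MF) : msub σ (msub τ a) = msub (fun p => msub σ (τ p)) a := by
  induction a with
  | var => rfl
  | bot => rfl
  | imp a c ia ic => simp [msub, ia, ic]
  | box n a ia => simp [msub, ia]

theorem msub_var (a : MF) : msub .var a = a := by
  induction a with
  | var => rfl
  | bot => rfl
  | imp a c ia ic => simp [msub, ia, ic]
  | box n a ia => simp [msub, ia]

theorem GLP.exists_glpOn {R : ℕ → ℕ → Prop} {φ : MF} (h : GLP R φ) (σ : ℕ → MF) :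
    ∃ F : Finset ℕ, ∀ l : List ℕ, (∀ x ∈ F, x ∈ l) → GLPOn R l (msub σ φ) := by
  induction h generalizing σ with
  | @taut a ha =>
    exact ⟨∅, fun l _ => .taut fun w hb hi =>
      ha (fun c => w (msub σ c)) hb fun c d => hi (msub σ c) (msub σ d)⟩
  | k n a c => exact ⟨{n}, fun l hl => .k n _ _ (hl n (by simp))⟩
  | lob n a => exact ⟨{n}, fun l hl => .lob n _ (hl n (by simp))⟩
  | @mono ξ ζ a hR =>
    exact ⟨{ξ, ζ}, fun l hl => .mono (msub σ a) (hl ξ (by simp)) (hl ζ (by simp)) hR⟩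
  | @stab ξ ζ a hR =>
    exact ⟨{ξ, ζ}, fun l hl => .stab (msub σ a) (hl ξ (by simp)) (hl ζ (by simp)) hR⟩
  | mp _ _ i1 i2 =>
    obtain ⟨F₁, h1⟩ := i1 σ
    obtain ⟨F₂, h2⟩ := i2 σ
    exact ⟨F₁ ∪ F₂, fun l hl => .mp (h1 l fun x hx => hl x (by simp [hx]))
      (h2 l fun x hx => hl x (by simp [hx]))⟩
  | subst τ _ i =>
    rw [msub_msub]
    exact i _
  | nec n _ i =>
    obtain ⟨F, h⟩ := i σ
    exact ⟨insert n F, fun l hl => .nec n (hl n (by simp)) (h l fun x hx => hl x (by simp [hx]))⟩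

theorem exists_pairwise_list {R : ℕ → ℕ → Prop} [IsWellOrder ℕ R] (F : Finset ℕ) :
    ∃ l : List ℕ, l.Pairwise R ∧ ∀ x, x ∈ l ↔ x ∈ F := by
  induction F using Finset.strongInduction with
  | H F ih =>
    rcases F.eq_empty_or_nonempty with rfl | hF
    · exact ⟨[], .nil, by simp⟩
    · obtain ⟨b, hb, hmin⟩ := (IsWellFounded.wf (r := R)).has_min (F : Set ℕ) hF
      obtain ⟨l, hl, hmem⟩ := ih _ (Finset.erase_ssubset hb)
      refine ⟨b :: l, List.pairwise_cons.2 ⟨fun x hx => ?_, hl⟩, fun x => ?_⟩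
      · rw [hmem, Finset.mem_erase] at hx
        rcases trichotomous_of R b x with h | h | h
        exacts [h, absurd h.symm hx.1, absurd h (hmin x hx.2)]
      · rw [List.mem_cons, hmem, Finset.mem_erase]
        by_cases h : x = b
        · simpa [h] using hb
        · simp [h]

/-- The modalities of a formula. -/
def mods : MF → Finset ℕ
  | .var _ => ∅
  | .bot => ∅
  | .imp a c => mods a ∪ mods c
  | .box n a => insert n (mods a)

theorem modsIn_of_forall_mem {l : List ℕ} {a : MF} (h : ∀ n ∈ mods a, n ∈ l) : ModsIn l a := by
  induction a with
  | var => trivial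
  | bot => trivial
  | imp a c ia ic =>
    exact ⟨ia fun n hn => h n (Finset.mem_union_left _ hn),
      ic fun n hn => h n (Finset.mem_union_right _ hn)⟩
  | box n a ia =>
    exact ⟨h n (Finset.mem_insert_self _ _), ia fun m hm => h m (Finset.mem_insert_of_mem hm)⟩

theorem mem_range_of_mem_mods_mapMod {e : ℕ → ℕ} {a : MF} {n : ℕ} (h : n ∈ mods (mapMod e a)) :
    n ∈ Set.range e := by
  induction a with
  | var => simp [mapMod, mods] at h
  | bot => simp [mapMod, mods] at h
  | imp a c ia ic =>
    rcases Finset.mem_union.1 h with h | h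
    exacts [ia h, ic h]
  | box m a ia =>
    rcases Finset.mem_insert.1 h with rfl | h
    exacts [⟨m, rfl⟩, ia h]

theorem mapMod_mapMod_of_leftInverse {e d : ℕ → ℕ} (h : Function.LeftInverse d e) (a : MF) :
    mapMod d (mapMod e a) = a := by
  induction a with
  | var => rfl
  | bot => rfl
  | imp a c ia ic => simp [mapMod, ia, ic]
  | box n a ia => simp [mapMod, ia, h n]

theorem MTaut.mapMod {a : MF} (ha : MTaut a) (g : ℕ → ℕ) : MTaut (mapMod g a) := fun w hb hi =>
  ha (fun c => w (SOA.mapMod g c)) hb fun c d => hi (SOA.mapMod g c) (SOA.mapMod g d)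

theorem GLPOn.mapMod {R Q : ℕ → ℕ → Prop} {l : List ℕ} {g : ℕ → ℕ}
    (hg : ∀ x ∈ l, ∀ y ∈ l, R x y → Q (g x) (g y)) {a : MF} (h : GLPOn R l a) :
    GLP Q (mapMod g a) := by
  induction h with
  | taut ha => exact .taut (ha.mapMod g)
  | k n a c _ => exact .k _ _ _
  | lob n a _ => exact .lob _ _
  | mono a h1 h2 hR => exact .mono (SOA.mapMod g a) (hg _ h1 _ h2 hR)
  | stab a h1 h2 hR => exact .stab (SOA.mapMod g a) (hg _ h1 _ h2 hR)
  | mp _ _ i1 i2 => exact .mp i1 i2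
  | nec n _ _ i => exact .nec _ i

theorem GLP.mapMod {R Q : ℕ → ℕ → Prop} {g : ℕ → ℕ} (hg : ∀ x y, R x y → Q (g x) (g y)) {a : MF}
    (h : GLP R a) : GLP Q (mapMod g a) := by
  obtain ⟨F, hF⟩ := h.exists_glpOn .var
  rw [msub_var] at hF
  exact (hF F.toList (by simp)).mapMod fun x _ y _ => hg x y

/-- (Corollary 8.4.) Let `≺` (here `R`) be a recursive
well-order on `ℕ` and let `e` enumerate, `≺`-increasingly, the modalities
`λ₀ ≺ … ≺ λ_N` of `φ = mapMod e ψ`, so that `ψ` is the condensation `φ̄` of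
`φ` (obtained by simultaneously replacing each `[λᵢ] = [e i]` by `[i]`).
Then `GLP_≺ ⊢ φ` iff `GLP_ω ⊢ φ̄`. -/
theorem condensation_provability_iff (R : ℕ → ℕ → Prop)
    (hwoR : IsWellOrder ℕ R)
    (hrec : ∃ g : ℕ → ℕ → Bool, Computable₂ g ∧ ∀ a b, R a b ↔ g a b = true)
    (e : ℕ → ℕ) (he : ∀ i j, i < j → R (e i) (e j)) (ψ : MF) :
    GLP R (mapMod e ψ) ↔ GLP (· < ·) ψ := by
  refine ⟨fun h => ?_, fun h => h.mapMod he⟩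
  obtain ⟨F, hF⟩ := h.exists_glpOn .var
  rw [msub_var] at hF
  obtain ⟨M, hM, hmem⟩ := exists_pairwise_list (R := R) (F ∪ mods (mapMod e ψ))
  let S := M.filter (· ∈ mods (mapMod e ψ))
  have hS : ModsIn S (mapMod e ψ) := modsIn_of_forall_mem fun n hn =>
    List.mem_filter.2 ⟨(hmem n).2 (Finset.mem_union_right _ hn), by simpa using hn⟩
  have h1 : GLPOn R S (mapMod e ψ) := (hF M fun x hx =>
    (hmem x).2 (Finset.mem_union_left _ hx)).eliminate List.filter_sublist hM hS
  have hinj : Function.Injective e := by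
    intro i j hij
    rcases lt_trichotomy i j with h | h | h
    · exact absurd (hij ▸ he i j h) (irrefl_of R _)
    · exact h
    · exact absurd (hij ▸ he j i h) (irrefl_of R _)
  have hleft := Function.leftInverse_invFun hinj
  have h2 : GLP (· < ·) (mapMod (Function.invFun e) (mapMod e ψ)) := by
    refine h1.mapMod fun x hx y hy hxy => ?_
    obtain ⟨i, rfl⟩ := mem_range_of_mem_mods_mapMod (by simpa using (List.mem_filter.1 hx).2)
    obtain ⟨j, rfl⟩ := mem_range_of_mem_mods_mapMod (by simpa using (List.mem_filter.1 hy).2)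
    rw [hleft i, hleft j]
    rcases lt_trichotomy i j with h | h | h
    · exact h
    · exact absurd (h ▸ hxy) (irrefl_of R _)
    · exact absurd (trans_of R hxy (he j i h)) (irrefl_of R _)
  rwa [mapMod_mapMod_of_leftInverse hleft] at h2

end SOA
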